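/- arXiv:1904.01496 — 3 statements merged into one kernel-verified Lean document; each statement's English description precedes it below -/
import Mathlib

section
/- Let T be a finite tree with at least 3 vertices and let S be a set of leaf-edges of T. Then there exists a star-node of T with respect to S (a vertex v together with three distinct edges e1, e2, e3 of S and pairwise edge-disjoint, possibly trivial, paths in T from v to the roots of e1, e2, e3 respectively) if and only if S contains at least three edges. -/
/-- An edge `e` of `G` is a *leaf-edge* if it is incident with a vertex of degree 1. -/
def IsLeafEdge {V : Type*} [Fintype V] (G : SimpleGraph V) [DecidableRel G.Adj]
    (e : Sym2 V) : Prop :=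
  e ∈ G.edgeSet ∧ ∃ v ∈ e, G.degree v = 1

/-- `r` is the *root* of the leaf-edge `e`: an endpoint of `e` of degree at least 2. -/
def IsRootOf {V : Type*} [Fintype V] (G : SimpleGraph V) [DecidableRel G.Adj]
    (r : V) (e : Sym2 V) : Prop :=
  r ∈ e ∧ 2 ≤ G.degree r

/-- A vertex `v` is a *star-node* with respect to a set `S` of leaf-edges if there are three
distinct edges of `S` and pairwise edge-disjoint (possibly trivial) paths from `v` to their
roots. -/
def IsStarNode {V : Type*} [Fintype V] (G : SimpleGraph V) [DecidableRel G.Adj]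
    (S : Set (Sym2 V)) (v : V) : Prop :=
  ∃ e1 e2 e3 : Sym2 V, e1 ∈ S ∧ e2 ∈ S ∧ e3 ∈ S ∧ e1 ≠ e2 ∧ e1 ≠ e3 ∧ e2 ≠ e3 ∧
    ∃ r1 r2 r3 : V, IsRootOf G r1 e1 ∧ IsRootOf G r2 e2 ∧ IsRootOf G r3 e3 ∧
      ∃ (p1 : G.Walk v r1) (p2 : G.Walk v r2) (p3 : G.Walk v r3),
        p1.IsPath ∧ p2.IsPath ∧ p3.IsPath ∧
        List.Disjoint p1.edges p2.edges ∧ List.Disjoint p1.edges p3.edges ∧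
        List.Disjoint p2.edges p3.edges


theorem exists_walk_to_set {V : Type*} (G : SimpleGraph V) (s : Set V) :
    ∀ {a b : V} (_ : G.Walk a b), b ∈ s →
      ∃ v ∈ s, ∃ q : G.Walk a v, ∀ e ∈ q.edges, ∃ x ∈ e, x ∉ s := by
  intro a b q
  induction q with
  | nil => intro hb; exact ⟨_, hb, .nil, by simp⟩
  | @cons a c b h q ih =>
    intro hb
    by_cases ha : a ∈ s
    · exact ⟨a, ha, .nil, by simp⟩
    · obtain ⟨v, hv, q', hq'⟩ := ih hb
      refine ⟨v, hv, .cons h q', ?_⟩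
      intro e he
      rw [SimpleGraph.Walk.edges_cons, List.mem_cons] at he
      rcases he with rfl | he
      · exact ⟨a, by simp, ha⟩
      · exact hq' e he

theorem exists_root {V : Type*} [Fintype V] (T : SimpleGraph V) [DecidableRel T.Adj]
    (hT : T.Connected) (hcard : 3 ≤ Fintype.card V) (e : Sym2 V) (he : IsLeafEdge T e) :
    ∃ r, IsRootOf T r e := by
  classical
  obtain ⟨he, a, ha, hd⟩ := he
  obtain ⟨b, rfl⟩ := ha
  rw [SimpleGraph.mem_edgeSet] at he
  refine ⟨b, by simp, ?_⟩
  by_contra hb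
  have hb1 : T.degree b = 1 := by
    have : 0 < T.degree b := (T.degree_pos_iff_exists_adj b).2 ⟨a, he.symm⟩
    omega
  obtain ⟨c, hc⟩ : ∃ c, c ∉ ({a, b} : Finset V) := by
    by_contra! h
    have h1 : Finset.univ ⊆ ({a, b} : Finset V) := fun x _ => h x
    have h2 := Finset.card_le_card h1
    have h3 : ({a, b} : Finset V).card ≤ 2 := Finset.card_le_two
    rw [Finset.card_univ] at h2
    omega
  obtain ⟨p⟩ := hT.preconnected a c
  obtain ⟨d, -, h1, h2⟩ := p.exists_boundary_dart ({a, b} : Set V) (by simp) (by simpa using hc)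
  rw [SimpleGraph.degree_eq_one_iff_existsUnique_adj] at hd hb1
  have hadj := d.adj
  simp only [Set.mem_insert_iff, Set.mem_singleton_iff] at h1 h2
  rcases h1 with h1 | h1
  · rw [h1] at hadj
    exact h2 (Or.inr (hd.unique hadj he))
  · rw [h1] at hadj
    exact h2 (Or.inl (hb1.unique hadj he.symm))

/-- In a finite tree with at least 3 vertices, given a set `S` of leaf-edges, a star-node
with respect to `S` exists if and only if `S` contains at least three edges. -/
theorem stmt3 {V : Type*} [Fintype V] (T : SimpleGraph V) [DecidableRel T.Adj]
    (hT : T.IsTree) (hcard : 3 ≤ Fintype.card V)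
    (S : Set (Sym2 V)) (hS : ∀ e ∈ S, IsLeafEdge T e) :
    (∃ v : V, IsStarNode T S v) ↔ 3 ≤ S.ncard := by
  classical
  have hfin : S.Finite := Set.toFinite S
  constructor
  · rintro ⟨v, e1, e2, e3, h1, h2, h3, h12, h13, h23, -⟩
    exact (Set.two_lt_ncard_iff hfin).2 ⟨e1, e2, e3, h1, h2, h3, h12, h13, h23⟩
  · intro h
    obtain ⟨e1, e2, e3, h1, h2, h3, h12, h13, h23⟩ := (Set.two_lt_ncard_iff hfin).1 h
    obtain ⟨r1, hr1⟩ := exists_root T hT.1 hcard e1 (hS _ h1)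
    obtain ⟨r2, hr2⟩ := exists_root T hT.1 hcard e2 (hS _ h2)
    obtain ⟨r3, hr3⟩ := exists_root T hT.1 hcard e3 (hS _ h3)
    obtain ⟨p, hp⟩ := hT.1.exists_isPath r1 r2
    obtain ⟨q⟩ := hT.1.preconnected r3 r1
    obtain ⟨v, hv, q', hq'⟩ := exists_walk_to_set T {x | x ∈ p.support} q (by simp)
    have hv : v ∈ p.support := hv
    have key : ∀ e ∈ p.edges, e ∉ q'.bypass.edges := by
      intro e he he'
      obtain ⟨x, hx, hxs⟩ := hq' e (q'.edges_bypass_subset_edges he')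
      exact hxs (p.mem_support_of_mem_edges he hx)
    have hdis : List.Disjoint (p.takeUntil v hv).edges (p.dropUntil v hv).edges := by
      have hn := hp.isTrail.edges_nodup
      rw [← p.take_spec hv, SimpleGraph.Walk.edges_append] at hn
      exact List.disjoint_of_nodup_append hn
    refine ⟨v, e1, e2, e3, h1, h2, h3, h12, h13, h23, r1, r2, r3, hr1, hr2, hr3,
      (p.takeUntil v hv).reverse, p.dropUntil v hv, q'.bypass.reverse,
      (hp.takeUntil hv).reverse, hp.dropUntil hv, q'.bypass_isPath.reverse, ?_, ?_, ?_⟩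
    · intro e he he'
      rw [SimpleGraph.Walk.edges_reverse, List.mem_reverse] at he
      exact hdis he he'
    · intro e he he'
      rw [SimpleGraph.Walk.edges_reverse, List.mem_reverse] at he he'
      exact key e (p.edges_takeUntil_subset_edges hv he) he'
    · intro e he he'
      rw [SimpleGraph.Walk.edges_reverse, List.mem_reverse] at he'
      exact key e (p.edges_dropUntil_subset_edges hv he) he'
end

section
/- Let T be a finite tree with at least 3 vertices and let S be a set of exactly four leaf-edges of T. Then exactly one of the following holds: (a) T has exactly one star-node with respect to S, and this star-node is a 4-SN, i.e., it admits pairwise edge-disjoint (possibly trivial) paths to the roots of all four edges of S; or (b) T has exactly two star-nodes with respect to S, and each of them is a 3-SN, i.e., each admits pairwise edge-disjoint paths to the roots of exactly three (and not all four) edges of S. -/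
/-- A star-node `v` is a *4-SN* with respect to `S` if there are four distinct edges of `S`
and pairwise edge-disjoint (possibly trivial) paths from `v` to their roots. -/
def Is4SN {V : Type*} [Fintype V] (G : SimpleGraph V) [DecidableRel G.Adj]
    (S : Set (Sym2 V)) (v : V) : Prop :=
  ∃ e1 e2 e3 e4 : Sym2 V, e1 ∈ S ∧ e2 ∈ S ∧ e3 ∈ S ∧ e4 ∈ S ∧
    e1 ≠ e2 ∧ e1 ≠ e3 ∧ e1 ≠ e4 ∧ e2 ≠ e3 ∧ e2 ≠ e4 ∧ e3 ≠ e4 ∧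
    ∃ r1 r2 r3 r4 : V,
      IsRootOf G r1 e1 ∧ IsRootOf G r2 e2 ∧ IsRootOf G r3 e3 ∧ IsRootOf G r4 e4 ∧
      ∃ (p1 : G.Walk v r1) (p2 : G.Walk v r2) (p3 : G.Walk v r3) (p4 : G.Walk v r4),
        p1.IsPath ∧ p2.IsPath ∧ p3.IsPath ∧ p4.IsPath ∧
        List.Disjoint p1.edges p2.edges ∧ List.Disjoint p1.edges p3.edges ∧
        List.Disjoint p1.edges p4.edges ∧ List.Disjoint p2.edges p3.edges ∧
        List.Disjoint p2.edges p4.edges ∧ List.Disjoint p3.edges p4.edges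

/-- A star-node `v` is a *3-SN* with respect to `S` if it is a star-node that admits pairwise
edge-disjoint paths to the roots of exactly three (and not four) edges of `S`. -/
def Is3SN {V : Type*} [Fintype V] (G : SimpleGraph V) [DecidableRel G.Adj]
    (S : Set (Sym2 V)) (v : V) : Prop :=
  IsStarNode G S v ∧ ¬ Is4SN G S v


namespace StarAux

open SimpleGraph

variable {V : Type*}

/-- `v` lies on every walk from `a` to `b`. -/
def B (G : SimpleGraph V) (a b v : V) : Prop := ∀ p : G.Walk a b, v ∈ p.support

/-- `v` is a median of `a`, `b`, `c`. -/
def M (G : SimpleGraph V) (a b c v : V) : Prop := B G a b v ∧ B G a c v ∧ B G b c v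

lemma B.symm {G : SimpleGraph V} {a b v : V} (h : B G a b v) : B G b a v := by
  intro p
  have := h p.reverse
  simpa using this

lemma B_right {G : SimpleGraph V} (a b : V) : B G a b b := fun p => p.end_mem_support

lemma B_left {G : SimpleGraph V} (a b : V) : B G a b a := fun p => p.start_mem_support

lemma B.split {G : SimpleGraph V} {a b v : V} (h : B G a b v) (d : V) :
    B G a d v ∨ B G d b v := by
  by_contra! hc
  obtain ⟨h1, h2⟩ := hc
  unfold B at h1 h2
  push Not at h1 h2
  obtain ⟨p, hp⟩ := h1
  obtain ⟨q, hq⟩ := h2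
  have := h (p.append q)
  rw [Walk.mem_support_append_iff] at this
  tauto

lemma B_of_path {G : SimpleGraph V} (hG : G.IsTree) {a b v : V} (p : G.Walk a b)
    (hp : p.IsPath) (hv : v ∈ p.support) : B G a b v := by
  classical
  intro q
  have := (hG.existsUnique_path a b).unique hp q.bypass_isPath
  rw [this] at hv
  exact q.support_bypass_subset_support hv

lemma B_antisymm {G : SimpleGraph V} (hG : G.IsTree) {x m n : V} (h1 : B G x n m)
    (h2 : B G x m n) : m = n := by
  classical
  obtain ⟨p, hp, -⟩ := hG.existsUnique_path x n
  by_contra hne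
  exact Walk.endpoint_notMem_support_takeUntil hp (h1 p) (Ne.symm hne) (h2 (p.takeUntil m (h1 p)))

lemma M_unique {G : SimpleGraph V} (hG : G.IsTree) {a b c m n : V} (h1 : M G a b c m)
    (h2 : M G a b c n) : m = n := by
  obtain ⟨x1, x2, x3⟩ := h1
  obtain ⟨y1, y2, y3⟩ := h2
  have key : ∀ x, B G x n m → B G x m n → m = n := fun x => B_antisymm hG
  have ka := key a
  have kb := key b
  have kc := key c
  have s1 := (x1.split n).imp id B.symm
  have s2 := (x2.split n).imp id B.symm
  have s3 := (x3.split n).imp id B.symm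
  have t1 := (y1.split m).imp id B.symm
  have t2 := (y2.split m).imp id B.symm
  have t3 := (y3.split m).imp id B.symm
  tauto

lemma B_of_adj {G : SimpleGraph V} (hG : G.IsTree) {c d a : V} (h : G.Adj c d)
    (hn : ¬ B G c a d) : B G d a c := by
  classical
  unfold B at hn
  push Not at hn
  obtain ⟨p, hp⟩ := hn
  refine B_of_path hG (Walk.cons h.symm p.bypass) ?_ ?_
  · rw [Walk.cons_isPath_iff]
    exact ⟨p.bypass_isPath, fun hh => hp (p.support_bypass_subset_support hh)⟩
  · simp

lemma B_trans {G : SimpleGraph V} {a b c d : V} (h1 : B G a b d) (h2 : B G a d c) :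
    B G a b c := by
  classical
  intro p
  exact p.support_takeUntil_subset_support (h1 p) (h2 _)

lemma B_step {G : SimpleGraph V} {c d a m : V} (h : G.Adj c d) (hb : B G a d m)
    (hne : m ≠ d) : B G a c m := by
  intro p
  have := hb (p.concat h)
  simp [Walk.support_concat] at this
  tauto

lemma M_exists_aux {G : SimpleGraph V} (hG : G.IsTree) (b : V) {c a : V} (p : G.Walk c a) :
    ∃ m, M G a b c m := by
  induction p with
  | nil => exact ⟨_, B_left _ _, B_left _ _, B_right _ _⟩
  | @cons c d a h p ih =>
    obtain ⟨m, h1, h2, h3⟩ := ih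
    by_cases hm : m = d
    · subst hm
      by_cases ha : B G c a m
      · by_cases hb : B G c b m
        · exact ⟨m, h1, ha.symm, hb.symm⟩
        · exact ⟨c, (B_trans h1.symm (B_of_adj hG h hb).symm).symm, B_right _ _, B_right _ _⟩
      · exact ⟨c, B_trans h1 (B_of_adj hG h ha).symm, B_right _ _, B_right _ _⟩
    · exact ⟨m, h1, B_step h h2 hm, B_step h h3 hm⟩

lemma M_exists {G : SimpleGraph V} (hG : G.IsTree) (a b c : V) : ∃ m, M G a b c m := by
  obtain ⟨p, -, -⟩ := hG.existsUnique_path c a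
  exact M_exists_aux hG b p

lemma B_iff_disjoint {G : SimpleGraph V} (hG : G.IsTree) {v a b : V} (p : G.Walk v a)
    (q : G.Walk v b) (hp : p.IsPath) (hq : q.IsPath) :
    List.Disjoint p.edges q.edges ↔ B G a b v := by
  classical
  constructor
  · intro h
    have ht : (p.reverse.append q).IsTrail := by
      rw [Walk.isTrail_append]
      refine ⟨hp.reverse.isTrail, hq.isTrail, ?_⟩
      rw [Walk.edges_reverse]
      intro x hx
      exact h (List.mem_reverse.1 hx)
    refine B_of_path hG _ ((hG.isAcyclic.isPath_iff_isTrail _).2 ht) ?_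
    simp [Walk.mem_support_append_iff]
  · intro h
    obtain ⟨w, hw, -⟩ := hG.existsUnique_path a b
    obtain ⟨p', q', hp', hq', he⟩ := hw.mem_support_iff_exists_append.1 (h w)
    have e1 : p.reverse = p' := (hG.existsUnique_path a v).unique hp.reverse hp'
    have e2 : q = q' := (hG.existsUnique_path v b).unique hq hq'
    subst e1 e2
    have ht := hw.isTrail
    rw [he, Walk.isTrail_append] at ht
    intro x hx hx'
    refine ht.2.2 ?_ hx'
    rw [Walk.edges_reverse]
    exact List.mem_reverse.2 hx

/-- All four points are pairwise separated by `v`. -/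
def All (G : SimpleGraph V) (a b c d v : V) : Prop :=
  B G a b v ∧ B G a c v ∧ B G a d v ∧ B G b c v ∧ B G b d v ∧ B G c d v

/-- `v` is a median of three of the four points. -/
def Star (G : SimpleGraph V) (a b c d v : V) : Prop :=
  M G a b c v ∨ M G a b d v ∨ M G a c d v ∨ M G b c d v

/-- The dichotomy for four points. -/
def Dich (G : SimpleGraph V) (a b c d : V) : Prop :=
  (∃ v, All G a b c d v ∧ ∀ w, Star G a b c d w → w = v) ∨
  (∃ u v, u ≠ v ∧ Star G a b c d u ∧ Star G a b c d v ∧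
    (∀ w, Star G a b c d w → w = u ∨ w = v) ∧ ¬ All G a b c d u ∧ ¬ All G a b c d v)

lemma B_comm {G : SimpleGraph V} {a b v : V} : B G a b v ↔ B G b a v := ⟨B.symm, B.symm⟩

lemma star_eq_of_all {G : SimpleGraph V} (hG : G.IsTree) {a b c d v w : V}
    (hv : All G a b c d v) (hw : Star G a b c d w) : w = v := by
  obtain ⟨h1, h2, h3, h4, h5, h6⟩ := hv
  rcases hw with hw | hw | hw | hw
  · exact M_unique hG hw ⟨h1, h2, h4⟩
  · exact M_unique hG hw ⟨h1, h3, h5⟩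
  · exact M_unique hG hw ⟨h2, h3, h6⟩
  · exact M_unique hG hw ⟨h4, h5, h6⟩

lemma dich_case {G : SimpleGraph V} (hG : G.IsTree) {a b c d m : V} (hm : M G a b c m)
    (hbd : B G b d m) (hcd : B G c d m) (had : ¬ B G a d m) : Dich G a b c d := by
  right
  obtain ⟨n, hn⟩ := M_exists hG a b d
  have hm' : M G b c d m := ⟨hm.2.2, hbd, hcd⟩
  obtain ⟨n1, n2, n3⟩ := hn
  have hne : m ≠ n := by rintro rfl; exact had n2
  have hA : ∀ v, All G a b c d v → m = v := fun v hv => star_eq_of_all hG hv (Or.inl hm)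
  have hA' : ∀ v, All G a b c d v → n = v :=
    fun v hv => star_eq_of_all hG hv (Or.inr (Or.inl ⟨n1, n2, n3⟩))
  have k1 : ¬ (B G a c n ∧ B G b c n) := fun h => hne (M_unique hG hm ⟨n1, h.1, h.2⟩)
  have k2 : ¬ (B G b c n ∧ B G c d n) := fun h => hne (M_unique hG hm' ⟨h.1, n3, h.2⟩)
  have s1 := (n1.split c).imp id B.symm
  have s2 := n2.split c
  have s3 := n3.split c
  have hn' : M G a c d n := by
    refine ⟨?_, n2, ?_⟩ <;> tauto
  refine ⟨m, n, hne, Or.inl hm, Or.inr (Or.inl ⟨n1, n2, n3⟩), ?_, ?_, ?_⟩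
  · rintro w (hw | hw | hw | hw)
    · exact Or.inl (M_unique hG hw hm)
    · exact Or.inr (M_unique hG hw ⟨n1, n2, n3⟩)
    · exact Or.inr (M_unique hG hw hn')
    · exact Or.inl (M_unique hG hw hm')
  · intro h
    exact had h.2.2.1
  · intro h
    exact hne (hA n h)

lemma Dich.perm {G : SimpleGraph V} {a b c d a' b' c' d' : V} (h : Dich G a b c d)
    (hA : ∀ v, All G a b c d v ↔ All G a' b' c' d' v)
    (hS : ∀ v, Star G a b c d v ↔ Star G a' b' c' d' v) : Dich G a' b' c' d' := by
  unfold Dich at *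
  simpa only [hA, hS] using h

lemma dich {G : SimpleGraph V} (hG : G.IsTree) (a b c d : V) : Dich G a b c d := by
  obtain ⟨m, hm⟩ := M_exists hG a b c
  have hm0 := hm
  obtain ⟨h1, h2, h3⟩ := hm
  have s1 := (h1.split d).imp id B.symm
  have s2 := (h2.split d).imp id B.symm
  have s3 := (h3.split d).imp id B.symm
  by_cases ha : B G a d m
  · by_cases hb : B G b d m
    · by_cases hc : B G c d m
      · left
        have hA : All G a b c d m := ⟨h1, h2, ha, h3, hb, hc⟩
        exact ⟨m, hA, fun w => star_eq_of_all hG hA⟩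
      · refine (dich_case hG (a := c) (b := b) (c := a) (d := d) (m := m)
          ⟨h3.symm, h2.symm, h1.symm⟩ hb ha hc).perm ?_ ?_
        · intro v
          unfold All
          rw [B_comm (a := c) (b := b), B_comm (a := c) (b := a), B_comm (a := b) (b := a)]
          tauto
        · intro v
          unfold Star M
          rw [B_comm (a := c) (b := b), B_comm (a := c) (b := a), B_comm (a := b) (b := a)]
          tauto
    · refine (dich_case hG (a := b) (b := a) (c := c) (d := d) (m := m)
          ⟨h1.symm, h3, h2⟩ ha (by tauto) hb).perm ?_ ?_
      · intro v
        unfold All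
        rw [B_comm (a := b) (b := a)]
        tauto
      · intro v
        unfold Star M
        rw [B_comm (a := b) (b := a)]
        tauto
  · exact dich_case hG hm0 (by tauto) (by tauto) ha

lemma root_unique [Fintype V] {G : SimpleGraph V} [DecidableRel G.Adj] {e : Sym2 V}
    (he : IsLeafEdge G e) {r s : V} (hr : IsRootOf G r e) (hs : IsRootOf G s e) : r = s := by
  by_contra hne
  obtain ⟨-, v, hv, hd⟩ := he
  have := (Sym2.mem_and_mem_iff hne).1 ⟨hr.1, hs.1⟩
  subst this
  have h1 := hr.2
  have h2 := hs.2
  rcases Sym2.mem_iff.1 hv with rfl | rfl <;> omega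

lemma root_exists [Fintype V] {G : SimpleGraph V} [DecidableRel G.Adj] (hG : G.IsTree)
    (hcard : 3 ≤ Fintype.card V) {e : Sym2 V} (he : IsLeafEdge G e) : ∃ r, IsRootOf G r e := by
  classical
  obtain ⟨hE, v, hv, hd⟩ := he
  obtain ⟨w, rfl⟩ := Sym2.mem_iff_exists.1 hv
  rw [mem_edgeSet] at hE
  refine ⟨w, by simp, ?_⟩
  by_contra hlt
  have hpos : 0 < G.degree w := (G.degree_pos_iff_exists_adj w).2 ⟨v, hE.symm⟩
  have hw : G.degree w = 1 := by omega
  have uv := (degree_eq_one_iff_existsUnique_adj.1 hd)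
  have uw := (degree_eq_one_iff_existsUnique_adj.1 hw)
  have key : ∀ (u z : V) (_ : G.Walk u z), (u = v ∨ u = w) → (z = v ∨ z = w) := by
    intro u z p
    induction p with
    | nil => exact id
    | cons h p ih =>
      rintro (rfl | rfl)
      · exact ih (Or.inr (uv.unique h hE))
      · exact ih (Or.inl (uw.unique h hE.symm))
  have hsub : (Finset.univ : Finset V) ⊆ {v, w} := by
    intro z _
    obtain ⟨p, -, -⟩ := hG.existsUnique_path v z
    simpa using key v z p (Or.inl rfl)
  have := (Finset.card_le_card hsub).trans Finset.card_le_two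
  rw [Finset.card_univ] at this
  omega

lemma exists_four {α : Type*} {S : Set α} (h : S.ncard = 4) : ∃ a b c d : α,
    a ≠ b ∧ a ≠ c ∧ a ≠ d ∧ b ≠ c ∧ b ≠ d ∧ c ≠ d ∧ S = {a, b, c, d} := by
  obtain ⟨a, t, hat, rfl, ht⟩ := (Set.ncard_eq_succ (Set.finite_of_ncard_ne_zero (by omega))).1 h
  obtain ⟨b, c, d, h1, h2, h3, rfl⟩ := Set.ncard_eq_three.1 ht
  simp only [Set.mem_insert_iff, Set.mem_singleton_iff, not_or] at hat
  exact ⟨a, b, c, d, hat.1, hat.2.1, hat.2.2, h1, h2, h3, rfl⟩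

lemma star_iff [Fintype V] {G : SimpleGraph V} [DecidableRel G.Adj] (hG : G.IsTree)
    (S : Set (Sym2 V)) (R : Sym2 V → V) (hR : ∀ e ∈ S, ∀ r, IsRootOf G r e ↔ r = R e) (v : V) :
    IsStarNode G S v ↔ ∃ e1 e2 e3 : Sym2 V, e1 ∈ S ∧ e2 ∈ S ∧ e3 ∈ S ∧ e1 ≠ e2 ∧ e1 ≠ e3 ∧
      e2 ≠ e3 ∧ M G (R e1) (R e2) (R e3) v := by
  constructor
  · rintro ⟨e1, e2, e3, h1, h2, h3, n1, n2, n3, r1, r2, r3, hr1, hr2, hr3, p1, p2, p3,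
      hp1, hp2, hp3, d1, d2, d3⟩
    refine ⟨e1, e2, e3, h1, h2, h3, n1, n2, n3, ?_⟩
    rw [← (hR _ h1 _).1 hr1, ← (hR _ h2 _).1 hr2, ← (hR _ h3 _).1 hr3]
    exact ⟨(B_iff_disjoint hG _ _ hp1 hp2).1 d1, (B_iff_disjoint hG _ _ hp1 hp3).1 d2,
      (B_iff_disjoint hG _ _ hp2 hp3).1 d3⟩
  · rintro ⟨e1, e2, e3, h1, h2, h3, n1, n2, n3, d1, d2, d3⟩
    obtain ⟨p1, hp1, -⟩ := hG.existsUnique_path v (R e1)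
    obtain ⟨p2, hp2, -⟩ := hG.existsUnique_path v (R e2)
    obtain ⟨p3, hp3, -⟩ := hG.existsUnique_path v (R e3)
    exact ⟨e1, e2, e3, h1, h2, h3, n1, n2, n3, R e1, R e2, R e3, (hR _ h1 _).2 rfl,
      (hR _ h2 _).2 rfl, (hR _ h3 _).2 rfl, p1, p2, p3, hp1, hp2, hp3,
      (B_iff_disjoint hG _ _ hp1 hp2).2 d1, (B_iff_disjoint hG _ _ hp1 hp3).2 d2,
      (B_iff_disjoint hG _ _ hp2 hp3).2 d3⟩

lemma four_iff [Fintype V] {G : SimpleGraph V} [DecidableRel G.Adj] (hG : G.IsTree)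
    (S : Set (Sym2 V)) (R : Sym2 V → V) (hR : ∀ e ∈ S, ∀ r, IsRootOf G r e ↔ r = R e) (v : V) :
    Is4SN G S v ↔ ∃ e1 e2 e3 e4 : Sym2 V, e1 ∈ S ∧ e2 ∈ S ∧ e3 ∈ S ∧ e4 ∈ S ∧ e1 ≠ e2 ∧
      e1 ≠ e3 ∧ e1 ≠ e4 ∧ e2 ≠ e3 ∧ e2 ≠ e4 ∧ e3 ≠ e4 ∧
      All G (R e1) (R e2) (R e3) (R e4) v := by
  constructor
  · rintro ⟨e1, e2, e3, e4, h1, h2, h3, h4, n1, n2, n3, n4, n5, n6, r1, r2, r3, r4,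
      hr1, hr2, hr3, hr4, p1, p2, p3, p4, hp1, hp2, hp3, hp4, d1, d2, d3, d4, d5, d6⟩
    refine ⟨e1, e2, e3, e4, h1, h2, h3, h4, n1, n2, n3, n4, n5, n6, ?_⟩
    rw [← (hR _ h1 _).1 hr1, ← (hR _ h2 _).1 hr2, ← (hR _ h3 _).1 hr3, ← (hR _ h4 _).1 hr4]
    exact ⟨(B_iff_disjoint hG _ _ hp1 hp2).1 d1, (B_iff_disjoint hG _ _ hp1 hp3).1 d2,
      (B_iff_disjoint hG _ _ hp1 hp4).1 d3, (B_iff_disjoint hG _ _ hp2 hp3).1 d4,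
      (B_iff_disjoint hG _ _ hp2 hp4).1 d5, (B_iff_disjoint hG _ _ hp3 hp4).1 d6⟩
  · rintro ⟨e1, e2, e3, e4, h1, h2, h3, h4, n1, n2, n3, n4, n5, n6, d1, d2, d3, d4, d5, d6⟩
    obtain ⟨p1, hp1, -⟩ := hG.existsUnique_path v (R e1)
    obtain ⟨p2, hp2, -⟩ := hG.existsUnique_path v (R e2)
    obtain ⟨p3, hp3, -⟩ := hG.existsUnique_path v (R e3)
    obtain ⟨p4, hp4, -⟩ := hG.existsUnique_path v (R e4)
    exact ⟨e1, e2, e3, e4, h1, h2, h3, h4, n1, n2, n3, n4, n5, n6, R e1, R e2, R e3, R e4,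
      (hR _ h1 _).2 rfl, (hR _ h2 _).2 rfl, (hR _ h3 _).2 rfl, (hR _ h4 _).2 rfl,
      p1, p2, p3, p4, hp1, hp2, hp3, hp4,
      (B_iff_disjoint hG _ _ hp1 hp2).2 d1, (B_iff_disjoint hG _ _ hp1 hp3).2 d2,
      (B_iff_disjoint hG _ _ hp1 hp4).2 d3, (B_iff_disjoint hG _ _ hp2 hp3).2 d4,
      (B_iff_disjoint hG _ _ hp2 hp4).2 d5, (B_iff_disjoint hG _ _ hp3 hp4).2 d6⟩

lemma star_iff' {α : Type*} {G : SimpleGraph V} {a b c d : α} (R : α → V) (hab : a ≠ b)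
    (hac : a ≠ c) (had : a ≠ d) (hbc : b ≠ c) (hbd : b ≠ d) (hcd : c ≠ d) (v : V) :
    (∃ e1 e2 e3 : α, e1 ∈ ({a, b, c, d} : Set α) ∧ e2 ∈ ({a, b, c, d} : Set α) ∧
      e3 ∈ ({a, b, c, d} : Set α) ∧ e1 ≠ e2 ∧ e1 ≠ e3 ∧
      e2 ≠ e3 ∧ M G (R e1) (R e2) (R e3) v) ↔ Star G (R a) (R b) (R c) (R d) v := by
  constructor
  · rintro ⟨e1, e2, e3, h1, h2, h3, n1, n2, n3, d1, d2, d3⟩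
    have d1' := d1.symm
    have d2' := d2.symm
    have d3' := d3.symm
    simp only [Set.mem_insert_iff, Set.mem_singleton_iff] at h1 h2 h3
    unfold Star M
    rcases h1 with rfl | rfl | rfl | rfl <;> rcases h2 with rfl | rfl | rfl | rfl <;>
      first
      | exact absurd rfl n1
      | (rcases h3 with rfl | rfl | rfl | rfl <;>
          first
          | exact absurd rfl n2
          | exact absurd rfl n3
          | simp only [*, true_and, and_true, true_or, or_true])
  · rintro (h | h | h | h)
    · exact ⟨a, b, c, by simp, by simp, by simp, hab, hac, hbc, h⟩
    · exact ⟨a, b, d, by simp, by simp, by simp, hab, had, hbd, h⟩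
    · exact ⟨a, c, d, by simp, by simp, by simp, hac, had, hcd, h⟩
    · exact ⟨b, c, d, by simp, by simp, by simp, hbc, hbd, hcd, h⟩

lemma four_iff' {α : Type*} {G : SimpleGraph V} {a b c d : α} (R : α → V) (hab : a ≠ b)
    (hac : a ≠ c) (had : a ≠ d) (hbc : b ≠ c) (hbd : b ≠ d) (hcd : c ≠ d) (v : V) :
    (∃ e1 e2 e3 e4 : α, e1 ∈ ({a, b, c, d} : Set α) ∧ e2 ∈ ({a, b, c, d} : Set α) ∧
      e3 ∈ ({a, b, c, d} : Set α) ∧ e4 ∈ ({a, b, c, d} : Set α) ∧ e1 ≠ e2 ∧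
      e1 ≠ e3 ∧ e1 ≠ e4 ∧ e2 ≠ e3 ∧ e2 ≠ e4 ∧ e3 ≠ e4 ∧
      All G (R e1) (R e2) (R e3) (R e4) v) ↔ All G (R a) (R b) (R c) (R d) v := by
  constructor
  · rintro ⟨e1, e2, e3, e4, h1, h2, h3, h4, n1, n2, n3, n4, n5, n6, d1, d2, d3, d4, d5, d6⟩
    have d1' := d1.symm
    have d2' := d2.symm
    have d3' := d3.symm
    have d4' := d4.symm
    have d5' := d5.symm
    have d6' := d6.symm
    simp only [Set.mem_insert_iff, Set.mem_singleton_iff] at h1 h2 h3 h4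
    unfold All
    rcases h1 with rfl | rfl | rfl | rfl <;> rcases h2 with rfl | rfl | rfl | rfl <;>
      first
      | exact absurd rfl n1
      | (rcases h3 with rfl | rfl | rfl | rfl <;>
          first
          | exact absurd rfl n2
          | exact absurd rfl n4
          | (rcases h4 with rfl | rfl | rfl | rfl <;>
              first
              | exact absurd rfl n3
              | exact absurd rfl n5
              | exact absurd rfl n6
              | (refine ⟨?_, ?_, ?_, ?_, ?_, ?_⟩ <;> assumption)))
  · intro h
    exact ⟨a, b, c, d, by simp, by simp, by simp, by simp, hab, hac, had, hbc, hbd, hcd, h⟩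

end StarAux

/-- In a finite tree with at least 3 vertices, for any set `S` of exactly four leaf-edges,
exactly one of the following holds: (a) there is exactly one star-node with respect to `S`
and it is a 4-SN; or (b) there are exactly two star-nodes with respect to `S` and each of
them is a 3-SN. -/
theorem stmt7 {V : Type*} [Fintype V] (T : SimpleGraph V) [DecidableRel T.Adj]
    (hT : T.IsTree) (hcard : 3 ≤ Fintype.card V)
    (S : Set (Sym2 V)) (hS : ∀ e ∈ S, IsLeafEdge T e) (hS4 : S.ncard = 4) :
    Xor'
      ((∃! v : V, IsStarNode T S v) ∧ ∀ v : V, IsStarNode T S v → Is4SN T S v)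
      (∃ u v : V, u ≠ v ∧ IsStarNode T S u ∧ IsStarNode T S v ∧
        (∀ w : V, IsStarNode T S w → w = u ∨ w = v) ∧ Is3SN T S u ∧ Is3SN T S v) := by
  classical
  have hex : ∀ e : Sym2 V, ∃ r : V, e ∈ S → IsRootOf T r e := by
    intro e
    by_cases he : e ∈ S
    · obtain ⟨r, hr⟩ := StarAux.root_exists hT hcard (hS e he)
      exact ⟨r, fun _ => hr⟩
    · obtain ⟨v⟩ := hT.connected.nonempty
      exact ⟨v, fun h => absurd h he⟩
  choose R hR0 using hex
  have hR : ∀ e ∈ S, ∀ r, IsRootOf T r e ↔ r = R e := by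
    intro e he r
    constructor
    · intro h
      exact StarAux.root_unique (hS e he) h (hR0 e he)
    · rintro rfl
      exact hR0 e he
  obtain ⟨a, b, c, d, hab, hac, had, hbc, hbd, hcd, hSeq⟩ := StarAux.exists_four hS4
  have hstar : ∀ v, IsStarNode T S v ↔ StarAux.Star T (R a) (R b) (R c) (R d) v := by
    intro v
    rw [StarAux.star_iff hT S R hR v, hSeq]
    exact StarAux.star_iff' R hab hac had hbc hbd hcd v
  have hfour : ∀ v, Is4SN T S v ↔ StarAux.All T (R a) (R b) (R c) (R d) v := by
    intro v
    rw [StarAux.four_iff hT S R hR v, hSeq]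
    exact StarAux.four_iff' R hab hac had hbc hbd hcd v
  have hdich := StarAux.dich hT (R a) (R b) (R c) (R d)
  unfold StarAux.Dich at hdich
  simp only [← hstar, ← hfour] at hdich
  rcases hdich with ⟨v, hv, hu⟩ | ⟨u, v, hne, hu, hv, hall, hnu, hnv⟩
  · have hsv : IsStarNode T S v := by
      rw [hstar]
      obtain ⟨h1, h2, h3, h4, h5, h6⟩ := (hfour v).1 hv
      exact Or.inl ⟨h1, h2, h4⟩
    left
    refine ⟨⟨⟨v, hsv, hu⟩, fun w hw => (hu w hw) ▸ hv⟩, ?_⟩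
    rintro ⟨x, y, hxy, hx, hy, -⟩
    exact hxy ((hu x hx).trans (hu y hy).symm)
  · right
    refine ⟨⟨u, v, hne, hu, hv, hall, ⟨hu, hnu⟩, ⟨hv, hnv⟩⟩, ?_⟩
    rintro ⟨-, h⟩
    exact hnu (h u hu)
end

section
/- Let T be a finite tree with at least 3 vertices, let S be a set of exactly four leaf-edges of T, and suppose T has exactly two star-nodes u and v with respect to S (so each of u and v is a 3-SN). Let e be an edge of T not belonging to S such that each of the two connected components of T with e deleted contains exactly two of the four edges of S. Then e lies on the unique path in T connecting u and v. -/
open SimpleGraph in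
lemma exists_root_aux {V : Type*} [Fintype V] (T : SimpleGraph V) [DecidableRel T.Adj]
    (hT : T.Connected) (hcard : 3 ≤ Fintype.card V) (f : Sym2 V) (hf : f ∈ T.edgeSet) :
    ∃ r, IsRootOf T r f := by
  classical
  induction f using Sym2.ind with
  | _ a b =>
  have hab : T.Adj a b := hf
  obtain ⟨z, hz⟩ : ∃ z, z ∉ ({a, b} : Finset V) := by
    by_contra! h
    have h1 : (Finset.univ : Finset V) ⊆ {a, b} := fun x _ => h x
    have h2 := Finset.card_le_card h1
    have h3 : ({a, b} : Finset V).card ≤ 2 := Finset.card_le_two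
    rw [Finset.card_univ] at h2
    omega
  obtain ⟨p⟩ := hT.preconnected a z
  obtain ⟨d, -, hd1, hd2⟩ := p.exists_boundary_dart (({a, b} : Finset V) : Set V)
    (by simp) (by simpa using hz)
  have key : ∀ x y w : V, T.Adj x y → T.Adj x w → y ≠ w → 2 ≤ T.degree x := by
    intro x y w h1 h2 h3
    rw [← T.card_neighborFinset_eq_degree, ← Finset.card_pair h3]
    apply Finset.card_le_card
    intro t ht
    simp only [Finset.mem_insert, Finset.mem_singleton] at ht
    rcases ht with rfl | rfl <;> simpa
  have hadj := d.adj
  simp only [Finset.coe_insert, Finset.coe_singleton, Set.mem_insert_iff,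
    Set.mem_singleton_iff, not_or] at hd1 hd2
  rcases hd1 with h | h
  · exact ⟨a, by simp, key a b d.snd hab (h ▸ hadj) (fun h' => hd2.2 h'.symm)⟩
  · exact ⟨b, by simp, key b a d.snd hab.symm (h ▸ hadj) (fun h' => hd2.1 h'.symm)⟩

open SimpleGraph in
lemma median_aux {V : Type*} (T : SimpleGraph V) (hT : T.Connected) {a b : V}
    (p : T.Walk a b) (hp : p.IsPath) (c : V) :
    ∃ w ∈ p.support, ∃ (p1 : T.Walk w a) (p2 : T.Walk w b) (p3 : T.Walk w c),
        p1.IsPath ∧ p2.IsPath ∧ p3.IsPath ∧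
        List.Disjoint p1.edges p2.edges ∧ List.Disjoint p1.edges p3.edges ∧
        List.Disjoint p2.edges p3.edges := by
  classical
  obtain ⟨w, hw, hmin⟩ := Finset.exists_min_image p.support.toFinset (fun x => T.dist x c)
    ⟨a, by simp⟩
  simp only [List.mem_toFinset] at hw hmin
  obtain ⟨q, hq, hql⟩ := hT.exists_path_of_dist w c
  have honly : ∀ x ∈ q.support, x ∈ p.support → x = w := by
    intro x hx hxp
    have h1 := hmin x hxp
    have h2 : T.dist x c ≤ (q.dropUntil x hx).length := dist_le _
    have h3 : (q.takeUntil x hx).length + (q.dropUntil x hx).length = q.length := by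
      rw [← Walk.length_append, Walk.take_spec]
    have h4 : (q.takeUntil x hx).length = 0 := by omega
    exact (Walk.eq_of_length_eq_zero h4).symm
  have hd : ∀ f ∈ p.edges, f ∉ q.edges := by
    intro f hf hfq
    induction f using Sym2.ind with
    | _ x y =>
    have hx := honly x (q.fst_mem_support_of_mem_edges hfq) (p.fst_mem_support_of_mem_edges hf)
    have hy := honly y (q.snd_mem_support_of_mem_edges hfq) (p.snd_mem_support_of_mem_edges hf)
    exact (p.adj_of_mem_edges hf).ne (hx.trans hy.symm)
  refine ⟨w, hw, (p.takeUntil w hw).reverse, p.dropUntil w hw, q,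
    (hp.takeUntil hw).reverse, hp.dropUntil hw, hq, ?_, ?_, ?_⟩
  · have := hp.isTrail.edges_nodup
    rw [← p.take_spec hw, Walk.edges_append, List.nodup_append'] at this
    intro f h1 h2
    rw [Walk.edges_reverse, List.mem_reverse] at h1
    exact this.2.2 h1 h2
  · intro f h1 h2
    rw [Walk.edges_reverse, List.mem_reverse] at h1
    exact hd f (p.edges_takeUntil_subset hw h1) h2
  · intro f h1 h2
    exact hd f (p.edges_dropUntil_subset hw h1) h2

open SimpleGraph in
lemma side_aux {V : Type*} [Fintype V] (T : SimpleGraph V) [DecidableRel T.Adj]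
    (hT : T.Connected) (hcard : 3 ≤ Fintype.card V)
    (S : Set (Sym2 V)) (hS : ∀ e ∈ S, IsLeafEdge T e) (e : Sym2 V)
    (hsplit : ∀ c : (T.deleteEdges {e}).ConnectedComponent,
      {f ∈ S | ∀ x ∈ f, x ∈ c.supp}.ncard = 2)
    (cA cB : (T.deleteEdges {e}).ConnectedComponent) (hne : cA ≠ cB) :
    ∃ w ∈ cA.supp, IsStarNode T S w := by
  classical
  obtain ⟨e1, e2, h12, hA⟩ := Set.ncard_eq_two.1 (hsplit cA)
  obtain ⟨e3, e4, h34, hB⟩ := Set.ncard_eq_two.1 (hsplit cB)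
  have m1 : e1 ∈ {f ∈ S | ∀ x ∈ f, x ∈ cA.supp} := by rw [hA]; simp
  have m2 : e2 ∈ {f ∈ S | ∀ x ∈ f, x ∈ cA.supp} := by rw [hA]; simp
  have m3 : e3 ∈ {f ∈ S | ∀ x ∈ f, x ∈ cB.supp} := by rw [hB]; simp
  obtain ⟨r1, hr1⟩ := exists_root_aux T hT hcard e1 (hS e1 m1.1).1
  obtain ⟨r2, hr2⟩ := exists_root_aux T hT hcard e2 (hS e2 m2.1).1
  obtain ⟨r3, hr3⟩ := exists_root_aux T hT hcard e3 (hS e3 m3.1).1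
  have c1 := m1.2 r1 hr1.1
  have c2 := m2.2 r2 hr2.1
  have c3 := m3.2 r3 hr3.1
  have h13 : e1 ≠ e3 := by
    rintro rfl
    have := m3.2 r1 hr1.1
    rw [ConnectedComponent.mem_supp_iff] at this c1
    exact hne (c1.symm.trans this)
  have h23 : e2 ≠ e3 := by
    rintro rfl
    have := m3.2 r2 hr2.1
    rw [ConnectedComponent.mem_supp_iff] at this c2
    exact hne (c2.symm.trans this)
  rw [ConnectedComponent.mem_supp_iff] at c1 c2
  obtain ⟨p, hp⟩ := (ConnectedComponent.exact (c1.trans c2.symm)).exists_isPath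
  have hle : T.deleteEdges {e} ≤ T := deleteEdges_le _
  obtain ⟨w, hw, p1, p2, p3, hh⟩ := median_aux T hT (p.mapLe hle) (hp.mapLe hle) r3
  refine ⟨w, ?_, e1, e2, e3, m1.1, m2.1, m3.1, h12, h13, h23, r1, r2, r3, hr1, hr2, hr3,
    p1, p2, p3, hh⟩
  rw [Walk.support_mapLe_eq_support] at hw
  rw [ConnectedComponent.mem_supp_iff, ← c1]
  exact ConnectedComponent.sound ⟨(p.takeUntil w hw).reverse⟩

/-- In a finite tree with at least 3 vertices, let `S` be a set of exactly four leaf-edges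
and suppose there are exactly two star-nodes `u` and `v` with respect to `S`, both 3-SNs.
If `e` is an edge of the tree not in `S` such that each connected component obtained by
deleting `e` contains exactly two of the four edges of `S`, then `e` lies on the unique
path connecting `u` and `v`. -/
theorem stmt8 {V : Type*} [Fintype V] (T : SimpleGraph V) [DecidableRel T.Adj]
    (hT : T.IsTree) (hcard : 3 ≤ Fintype.card V)
    (S : Set (Sym2 V)) (hS : ∀ e ∈ S, IsLeafEdge T e) (hS4 : S.ncard = 4)
    (u v : V) (huv : u ≠ v) (hu : IsStarNode T S u) (hv : IsStarNode T S v)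
    (honly : ∀ w : V, IsStarNode T S w → w = u ∨ w = v)
    (hu3 : Is3SN T S u) (hv3 : Is3SN T S v)
    (e : Sym2 V) (he : e ∈ T.edgeSet) (heS : e ∉ S)
    (hsplit : ∀ c : (T.deleteEdges {e}).ConnectedComponent,
      {f ∈ S | ∀ x ∈ f, x ∈ c.supp}.ncard = 2) :
    ∀ p : T.Walk u v, p.IsPath → e ∈ p.edges := by
  classical
  intro p hp
  by_contra hep
  induction e using Sym2.ind with
  | _ x y =>
  have hb : T.IsBridge s(x, y) := SimpleGraph.isAcyclic_iff_forall_edge_isBridge.1 hT.isAcyclic he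
  have hnr : ¬ (T.deleteEdges {s(x, y)}).Reachable x y := by
    rw [SimpleGraph.isBridge_iff] at hb
    first | exact hb | exact hb.2
  have hne : (T.deleteEdges {s(x, y)}).connectedComponentMk x ≠
      (T.deleteEdges {s(x, y)}).connectedComponentMk y :=
    fun h => hnr (SimpleGraph.ConnectedComponent.exact h)
  obtain ⟨w1, hw1, s1⟩ := side_aux T hT.connected hcard S hS _ hsplit _ _ hne
  obtain ⟨w2, hw2, s2⟩ := side_aux T hT.connected hcard S hS _ hsplit _ _ hne.symm
  rw [SimpleGraph.ConnectedComponent.mem_supp_iff] at hw1 hw2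
  have huv' : (T.deleteEdges {s(x, y)}).connectedComponentMk u =
      (T.deleteEdges {s(x, y)}).connectedComponentMk v :=
    SimpleGraph.ConnectedComponent.sound ⟨p.toDeleteEdge s(x, y) hep⟩
  apply hne
  rw [← hw1, ← hw2]
  rcases honly w1 s1 with rfl | rfl <;> rcases honly w2 s2 with rfl | rfl <;>
    first | rfl | exact huv' | exact huv'.symm
end
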